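/- Let a, b, b' ∈ ℂ with a not a nonpositive integer, and let x, y ∈ ℂ with |x| < 1/4 and |y| < 1/4. Then the series defining F₂(a,b,b',a,a;x,y) and the Gauss series F(b, b', a; xy/((1−x)(1−y))) converge absolutely, and F₂(a, b, b', a, a; x, y) = (1−x)^(−b) · (1−y)^(−b') · F(b, b', a; xy/((1−x)(1−y))), where the powers are principal branches. -/

import Mathlib

noncomputable section

/-- The ascending Pochhammer symbol `(a)ₙ = a(a+1)⋯(a+n−1)` for a complex number `a`. -/
def poch (a : ℂ) (n : ℕ) : ℂ := (ascPochhammer ℂ n).eval a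

/-- General term of Appell's double series `F₂(a,b,b',c,c';x,y)`. -/
def F2term (a b b' c c' x y : ℂ) (ij : ℕ × ℕ) : ℂ :=
  poch a (ij.1 + ij.2) * poch b ij.1 * poch b' ij.2 /
    (poch c ij.1 * poch c' ij.2 * (Nat.factorial ij.1 : ℂ) * (Nat.factorial ij.2 : ℂ)) *
    x ^ ij.1 * y ^ ij.2

/-- General term of Appell's double series `F₁(a,b,b',c;x,y)`. -/
def F1term (a b b' c x y : ℂ) (ij : ℕ × ℕ) : ℂ :=
  poch a (ij.1 + ij.2) * poch b ij.1 * poch b' ij.2 /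
    (poch c (ij.1 + ij.2) * (Nat.factorial ij.1 : ℂ) * (Nat.factorial ij.2 : ℂ)) *
    x ^ ij.1 * y ^ ij.2

/-- General term of the Gauss hypergeometric series `F(a,b,c;x)`. -/
def Fterm (a b c x : ℂ) (i : ℕ) : ℂ :=
  poch a i * poch b i / (poch c i * (Nat.factorial i : ℂ)) * x ^ i

open Filter Topology in
theorem poch_succ (a : ℂ) (n : ℕ) : poch a (n + 1) = poch a n * (a + n) := by
  simp [poch, ascPochhammer_succ_eval]

theorem poch_zero (a : ℂ) : poch a 0 = 1 := by
  simp [poch]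

theorem poch_add (a : ℂ) (n m : ℕ) : poch a (n + m) = poch a n * poch (a + n) m := by
  induction m with
  | zero => simp [poch_zero]
  | succ m ih =>
    rw [← add_assoc, poch_succ, ih, poch_succ]
    push_cast
    ring

theorem poch_ne (a : ℂ) (ha : ∀ n : ℕ, a ≠ -(n : ℂ)) (n : ℕ) : poch a n ≠ 0 := by
  induction n with
  | zero => simp [poch_zero]
  | succ n ih =>
    rw [poch_succ]
    refine mul_ne_zero ih fun h => ha n (eq_neg_of_add_eq_zero_left h)

theorem choose_poch {K : Type*} [Field K] [CharZero K] [BinomialRing K] (a : K) (n : ℕ) :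
    Ring.choose (a + n - 1) n = (ascPochhammer K n).eval a / (Nat.factorial n : K) := by
  have h : (Nat.factorial n : K) ≠ 0 := by exact_mod_cast Nat.factorial_ne_zero n
  rw [← Ring.multichoose_eq, eq_div_iff h, ← Polynomial.ascPochhammer_smeval_eq_eval,
    ← Ring.factorial_nsmul_multichoose_eq_ascPochhammer, nsmul_eq_mul, mul_comm]

theorem hasSum_poch (b x : ℂ) (hx : ‖x‖ < 1) :
    HasSum (fun n : ℕ => poch b n / (Nat.factorial n : ℂ) * x ^ n) ((1 - x) ^ (-b)) := by
  have h := (Complex.one_div_one_sub_cpow_hasFPowerSeriesOnBall_zero b).hasSum (y := x)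
    (by rw [← ENNReal.ofReal_one, Metric.eball_ofReal]; simpa using hx)
  simpa only [FormalMultilinearSeries.ofScalars_apply_eq, choose_poch, zero_add, smul_eq_mul,
    one_div, ← Complex.cpow_neg] using! h

theorem hasSum_poch_real (b x : ℝ) (hx0 : 0 ≤ x) (hx : x < 1) :
    HasSum (fun n : ℕ => (ascPochhammer ℝ n).eval b / (Nat.factorial n : ℝ) * x ^ n)
      ((1 - x) ^ (-b)) := by
  have h := (Real.one_div_one_sub_rpow_hasFPowerSeriesOnBall_zero b).hasSum (y := x)
    (by rw [← ENNReal.ofReal_one, Metric.eball_ofReal]; simpa [abs_of_nonneg hx0] using hx)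
  have h1 : 0 ≤ 1 - x := by linarith
  simpa only [FormalMultilinearSeries.ofScalars_apply_eq, choose_poch, zero_add, smul_eq_mul,
    one_div, ← Real.rpow_neg h1] using! h

theorem norm_poch_le (b : ℂ) (k m : ℕ) :
    ‖poch (b + k) m‖ ≤ (ascPochhammer ℝ m).eval (‖b‖ + k) := by
  induction m with
  | zero => simp [poch_zero]
  | succ m ih =>
    rw [poch_succ, norm_mul, ascPochhammer_succ_eval]
    have : ‖b + k + m‖ ≤ ‖b‖ + k + m := by
      refine (norm_add_le _ _).trans ?_
      refine add_le_add ((norm_add_le _ _).trans ?_) ?_ <;> simp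
    exact mul_le_mul ih this (norm_nonneg _) ((norm_nonneg _).trans ih)

open Filter Topology in
theorem summable_Fterm (b b' a z : ℂ) (hz : ‖z‖ < 1) :
    Summable (fun i : ℕ => ‖Fterm b b' a z i‖) := by
  obtain ⟨q, hq1, hq2⟩ := exists_between hz
  have h1 := tendsto_add_mul_div_add_mul_atTop_nhds b a 1 (one_ne_zero (α := ℂ))
  have h2 := tendsto_add_mul_div_add_mul_atTop_nhds b' 1 1 (one_ne_zero (α := ℂ))
  have h3 := (((h1.mul h2).mul_const z)).norm
  simp only [one_mul, div_one] at h3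
  have h4 := h3.eventually_lt_const hq1
  refine summable_of_ratio_norm_eventually_le hq2 ?_
  filter_upwards [h4] with n hn
  have : Fterm b b' a z (n + 1) =
      ((b + n) / (a + n) * ((b' + n) / (1 + n)) * z) * Fterm b b' a z n := by
    simp only [Fterm, poch_succ, Nat.factorial_succ, pow_succ, div_eq_mul_inv, mul_inv]
    push_cast
    rw [mul_inv, add_comm (n : ℂ) 1]
    ring
  rw [this, norm_norm, norm_norm, norm_mul]
  exact mul_le_mul_of_nonneg_right hn.le (norm_nonneg _)

/-- Chu-Vandermonde. -/
theorem vander (a : ℂ) (i j : ℕ) :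
    ∑ k ∈ Finset.range (i + 1), (Nat.choose j k : ℂ) *
      (poch (a + k) (i - k) / (Nat.factorial (i - k) : ℂ)) =
      poch (a + j) i / (Nat.factorial i : ℂ) := by
  have h := Ring.add_choose_eq (r := (j : ℂ)) (s := a + i - 1) i (Commute.all _ _)
  have e : (j : ℂ) + (a + i - 1) = (a + j) + i - 1 := by ring
  rw [e, choose_poch, Finset.Nat.sum_antidiagonal_eq_sum_range_succ_mk] at h
  unfold poch
  rw [h]
  refine Finset.sum_congr rfl fun k hk => ?_
  have hk' : k ≤ i := by simpa [Nat.lt_succ_iff] using hk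
  have e2 : a + (i : ℂ) - 1 = (a + k) + ((i - k : ℕ) : ℂ) - 1 := by
    rw [Nat.cast_sub hk']; ring
  dsimp only
  rw [Ring.choose_natCast, e2, choose_poch]

/-- The triple series term. -/
def Tterm (a b b' x y : ℂ) (p : ℕ × (ℕ × ℕ)) : ℂ :=
  Fterm b b' a (x * y) p.1 *
    ((poch (b + p.1) p.2.1 / (Nat.factorial p.2.1 : ℂ) * x ^ p.2.1) *
      (poch (b' + p.1) p.2.2 / (Nat.factorial p.2.2 : ℂ) * y ^ p.2.2))

def Gterm (a b b' x y : ℂ) (p : (ℕ × ℕ) × ℕ) : ℂ :=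
  if p.2 ≤ p.1.1 ∧ p.2 ≤ p.1.2 then
    Tterm a b b' x y (p.2, (p.1.1 - p.2, p.1.2 - p.2)) else 0

def emap (p : ℕ × (ℕ × ℕ)) : (ℕ × ℕ) × ℕ := ((p.1 + p.2.1, p.1 + p.2.2), p.1)

theorem emap_inj : Function.Injective emap := by
  rintro ⟨k, m, n⟩ ⟨k', m', n'⟩ h
  simp only [emap, Prod.mk.injEq] at h ⊢
  omega

theorem Gterm_zero (a b b' x y : ℂ) (p) (hp : p ∉ Set.range emap) : Gterm a b b' x y p = 0 := by
  unfold Gterm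
  rw [if_neg]
  rintro ⟨h1, h2⟩
  refine hp ⟨(p.2, (p.1.1 - p.2, p.1.2 - p.2)), ?_⟩
  simp only [emap, Nat.add_sub_cancel' h1, Nat.add_sub_cancel' h2]

theorem Gterm_comp (a b b' x y : ℂ) : Gterm a b b' x y ∘ emap = Tterm a b b' x y := by
  funext p
  simp [Gterm, emap]

theorem sum_Gterm (a b b' : ℂ) (ha : ∀ n : ℕ, a ≠ -(n : ℂ)) (x y : ℂ) (ij : ℕ × ℕ) :
    HasSum (fun k => Gterm a b b' x y (ij, k)) (F2term a b b' a a x y ij) := by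
  obtain ⟨i, j⟩ := ij
  have h0 : ∀ k ∉ Finset.range (i + 1), Gterm a b b' x y ((i, j), k) = 0 := by
    intro k hk
    simp only [Gterm]
    rw [if_neg]
    simp at hk
    omega
  have hs : HasSum (fun k => Gterm a b b' x y ((i, j), k)) _ := hasSum_sum_of_ne_finset_zero h0
  convert hs using 1
  have hai := poch_ne a ha i
  have haj := poch_ne a ha j
  have hfi : (Nat.factorial i : ℂ) ≠ 0 := by exact_mod_cast Nat.factorial_ne_zero i
  have hfj : (Nat.factorial j : ℂ) ≠ 0 := by exact_mod_cast Nat.factorial_ne_zero j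
  have key : F2term a b b' a a x y (i, j) = poch b i * poch b' j * x ^ i * y ^ j /
      (poch a i * (Nat.factorial j : ℂ)) * (poch (a + j) i / (Nat.factorial i : ℂ)) := by
    simp only [F2term]
    rw [add_comm i j, poch_add a j i]
    field_simp
  rw [key, ← vander, Finset.mul_sum]
  refine Finset.sum_congr rfl fun k hk => ?_
  have hki : k ≤ i := by simpa [Nat.lt_succ_iff] using hk
  simp only [Gterm]
  by_cases hkj : k ≤ j
  · rw [if_pos ⟨hki, hkj⟩]
    obtain ⟨m, rfl⟩ := Nat.exists_eq_add_of_le hki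
    obtain ⟨n, rfl⟩ := Nat.exists_eq_add_of_le hkj
    simp only [Tterm, Fterm, Nat.add_sub_cancel_left]
    have hk0 := poch_ne a ha k
    have hfk : (Nat.factorial k : ℂ) ≠ 0 := by exact_mod_cast Nat.factorial_ne_zero k
    have hfm : (Nat.factorial m : ℂ) ≠ 0 := by exact_mod_cast Nat.factorial_ne_zero m
    have hfn : (Nat.factorial n : ℂ) ≠ 0 := by exact_mod_cast Nat.factorial_ne_zero n
    have hc : ((Nat.choose (k + n) k : ℕ) : ℂ) =
        (Nat.factorial (k + n) : ℂ) / ((Nat.factorial k : ℂ) * (Nat.factorial n : ℂ)) := by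
      rw [eq_div_iff (mul_ne_zero hfk hfn)]
      have := Nat.choose_mul_factorial_mul_factorial hkj
      rw [Nat.add_sub_cancel_left] at this
      rw [← mul_assoc]
      exact_mod_cast this
    rw [poch_add a k m] at hai ⊢
    have ham := right_ne_zero_of_mul hai
    rw [hc, poch_add b, poch_add b', mul_pow, pow_add, pow_add]
    field_simp
  · rw [if_neg (fun h => hkj h.2), Nat.choose_eq_zero_of_lt (not_le.mp hkj)]
    simp

theorem Fterm_mul (b b' a z w : ℂ) (k : ℕ) : Fterm b b' a (z * w) k = Fterm b b' a z k * w ^ k := by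
  simp only [Fterm, mul_pow]; ring

set_option maxHeartbeats 1000000 in
theorem summable_Tterm (a b b' x y : ℂ) (hx : ‖x‖ < 1 / 4) (hy : ‖y‖ < 1 / 4) :
    Summable (fun p => ‖Tterm a b b' x y p‖) := by
  set g : ℕ × (ℕ × ℕ) → ℝ := fun p => ‖Fterm b b' a (x * y) p.1‖ *
    (((ascPochhammer ℝ p.2.1).eval (‖b‖ + p.1) / (Nat.factorial p.2.1 : ℝ) * ‖x‖ ^ p.2.1) *
      ((ascPochhammer ℝ p.2.2).eval (‖b'‖ + p.1) / (Nat.factorial p.2.2 : ℝ) * ‖y‖ ^ p.2.2))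
    with hg
  have nn : ∀ (c : ℂ) (k m : ℕ), 0 ≤ (ascPochhammer ℝ m).eval (‖c‖ + k) := fun c k m =>
    (norm_nonneg _).trans (norm_poch_le c k m)
  have g0 : 0 ≤ g := by
    intro p
    have := nn b p.1 p.2.1
    have := nn b' p.1 p.2.2
    simp only [hg, Pi.zero_apply]
    positivity
  have hgs : Summable g := by
    have A := fun k : ℕ => hasSum_poch_real (‖b‖ + k) ‖x‖ (norm_nonneg _) (by linarith)
    have B := fun k : ℕ => hasSum_poch_real (‖b'‖ + k) ‖y‖ (norm_nonneg _) (by linarith)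
    have AB : ∀ k : ℕ, HasSum (fun q : ℕ × ℕ => g (k, q)) (‖Fterm b b' a (x * y) k‖ *
        ((1 - ‖x‖) ^ (-(‖b‖ + k)) * (1 - ‖y‖) ^ (-(‖b'‖ + k)))) := by
      intro k
      have hs : Summable _ := (A k).summable.mul_of_nonneg (B k).summable ?_ ?_
      · exact ((A k).mul (B k) hs).mul_left ‖Fterm b b' a (x * y) k‖
      · intro m
        have := nn b k m
        simp only [Pi.zero_apply]
        positivity
      · intro m
        have := nn b' k m
        simp only [Pi.zero_apply]
        positivity
    rw [summable_prod_of_nonneg g0]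
    refine ⟨fun k => (AB k).summable, ?_⟩
    simp only [(AB _).tsum_eq]
    have hx1 : 0 < 1 - ‖x‖ := by linarith
    have hy1 : 0 < 1 - ‖y‖ := by linarith
    have hz : ‖x * y * (((1 - ‖x‖)⁻¹ * (1 - ‖y‖)⁻¹ : ℝ) : ℂ)‖ < 1 := by
      rw [norm_mul, norm_mul, Complex.norm_real, Real.norm_of_nonneg (by positivity),
        ← mul_inv, ← div_eq_mul_inv, div_lt_one (by positivity)]
      nlinarith [norm_nonneg x, norm_nonneg y]
    refine ((summable_Fterm b b' a _ hz).mul_left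
      ((1 - ‖x‖) ^ (-‖b‖) * (1 - ‖y‖) ^ (-‖b'‖))).congr fun k => ?_
    rw [Fterm_mul, norm_mul, norm_pow, Complex.norm_real, Real.norm_of_nonneg (by positivity),
      neg_add, neg_add, Real.rpow_add hx1, Real.rpow_add hy1, Real.rpow_neg hx1.le (k : ℝ),
      Real.rpow_neg hy1.le (k : ℝ), Real.rpow_natCast, Real.rpow_natCast, mul_pow, inv_pow, inv_pow]
    ring
  refine hgs.of_nonneg_of_le (fun _ => norm_nonneg _) fun p => ?_
  simp only [hg, Tterm, norm_mul, norm_div, norm_pow, Complex.norm_natCast]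
  have h1 := norm_poch_le b p.1 p.2.1
  have h2 := norm_poch_le b' p.1 p.2.2
  have := nn b p.1 p.2.1
  have := nn b' p.1 p.2.2
  gcongr

theorem one_sub_bound (x : ℂ) (hx : ‖x‖ < 1 / 4) : 3 / 4 < ‖1 - x‖ := by
  have := norm_sub_norm_le 1 x
  rw [norm_one] at this
  linarith

/-- Fact 1.7 (Bailey): `F₂(a,b,b',a,a;x,y) = (1−x)^(−b) (1−y)^(−b') F(b,b',a; xy/((1−x)(1−y)))`,
together with the absolute convergence of both series, for `|x| < 1/4`, `|y| < 1/4`,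
and `a` not a nonpositive integer. -/
theorem stmt5 (a b b' : ℂ) (ha : ∀ n : ℕ, a ≠ -(n : ℂ))
    (x y : ℂ) (hx : ‖x‖ < 1 / 4) (hy : ‖y‖ < 1 / 4) :
    Summable (fun ij : ℕ × ℕ => ‖F2term a b b' a a x y ij‖) ∧
    Summable (fun i : ℕ => ‖Fterm b b' a (x * y / ((1 - x) * (1 - y))) i‖) ∧
    ∑' ij : ℕ × ℕ, F2term a b b' a a x y ij =
      (1 - x) ^ (-b) * (1 - y) ^ (-b') *
        ∑' i : ℕ, Fterm b b' a (x * y / ((1 - x) * (1 - y))) i := by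
  have hx1 := one_sub_bound x hx
  have hy1 := one_sub_bound y hy
  have hx0 : 1 - x ≠ 0 := by rw [← norm_pos_iff]; linarith
  have hy0 : 1 - y ≠ 0 := by rw [← norm_pos_iff]; linarith
  have hz : ‖x * y / ((1 - x) * (1 - y))‖ < 1 := by
    rw [norm_div, norm_mul, norm_mul, div_lt_one (by positivity)]
    nlinarith [norm_nonneg x, norm_nonneg y]
  have hT := summable_Tterm a b b' x y hx hy
  have hGn : Summable (fun p => ‖Gterm a b b' x y p‖) := by
    rw [← emap_inj.summable_iff (fun p hp => by rw [Gterm_zero _ _ _ _ _ _ hp, norm_zero])]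
    refine hT.congr fun p => ?_
    rw [← Gterm_comp]; rfl
  have hF := summable_Fterm b b' a _ hz
  have hG := hGn.of_norm
  refine ⟨?_, hF, ?_⟩
  · have h2 := (summable_prod_of_nonneg (fun p => norm_nonneg _)).1 hGn
    refine h2.2.of_nonneg_of_le (fun _ => norm_nonneg _) fun ij => ?_
    rw [← (sum_Gterm a b b' ha x y ij).tsum_eq]
    exact norm_tsum_le_tsum_norm (h2.1 ij)
  · have e1 := (hG.hasSum.prod_fiberwise (sum_Gterm a b b' ha x y)).tsum_eq
    have e2 : HasSum (Tterm a b b' x y) (∑' p, Gterm a b b' x y p) := by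
      rw [← Gterm_comp, emap_inj.hasSum_iff (Gterm_zero a b b' x y)]
      exact hG.hasSum
    have A := fun k : ℕ => hasSum_poch (b + k) x (by linarith)
    have B := fun k : ℕ => hasSum_poch (b' + k) y (by linarith)
    have AB : ∀ k : ℕ, HasSum (fun q : ℕ × ℕ => Tterm a b b' x y (k, q))
        (Fterm b b' a (x * y) k * ((1 - x) ^ (-(b + k)) * (1 - y) ^ (-(b' + k)))) := by
      intro k
      have hs := summable_mul_of_summable_norm (A k).summable.norm (B k).summable.norm
      exact ((A k).mul (B k) hs).mul_left (Fterm b b' a (x * y) k)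
    have e3 := e2.prod_fiberwise AB
    rw [e1, ← e3.tsum_eq, ← tsum_mul_left]
    refine tsum_congr fun k => ?_
    rw [div_eq_mul_inv, Fterm_mul _ _ _ (x * y), neg_add, neg_add, Complex.cpow_add _ _ hx0,
      Complex.cpow_add _ _ hy0, Complex.cpow_neg _ (k : ℂ), Complex.cpow_neg _ (k : ℂ),
      Complex.cpow_natCast, Complex.cpow_natCast, inv_pow, mul_pow, mul_inv]
    ring
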